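/- There do not exist finite abelian groups A and B together with group homomorphisms f : A → B, g : B → ℤ/3ℤ, h : ℤ/3ℤ → B, k : B → A such that f is injective, the pairs (f,g), (g,h), (h,k) are exact, and k is surjective. -/

import Mathlib

/-- For an exact pair of homomorphisms, the order of the middle group is the product of the orders
of the two images. -/
theorem AddMonoidHom.card_range_mul_card_range_of_exact {A B C : Type*} [AddGroup A] [AddGroup B]
    [AddGroup C] {f : A →+ B} {g : B →+ C} (hfg : Function.Exact f g) :
    Nat.card f.range * Nat.card g.range = Nat.card B := by
  rw [← AddMonoidHom.exact_iff.mp hfg, ← AddSubgroup.index_ker, AddSubgroup.card_mul_index]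

theorem stmt_3
    (A B : Type) [AddCommGroup A] [AddCommGroup B] [Finite A] [Finite B]
    (f : A →+ B) (g : B →+ ZMod 3) (h : ZMod 3 →+ B) (k : B →+ A)
    (hf : Function.Injective ⇑f)
    (hfg : Function.Exact ⇑f ⇑g) (hgh : Function.Exact ⇑g ⇑h) (hhk : Function.Exact ⇑h ⇑k)
    (hk : Function.Surjective ⇑k) : False := by
  have card_f : Nat.card f.range = Nat.card A :=
    (Nat.card_congr (AddMonoidHom.ofInjective hf).toEquiv).symm
  have card_k : Nat.card k.range = Nat.card A := by
    rw [AddMonoidHom.range_eq_top.mpr hk, AddSubgroup.card_top]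
  have at_left := AddMonoidHom.card_range_mul_card_range_of_exact hfg
  have at_middle := AddMonoidHom.card_range_mul_card_range_of_exact hgh
  have at_right := AddMonoidHom.card_range_mul_card_range_of_exact hhk
  rw [card_f] at at_left
  rw [card_k, mul_comm, ← at_left] at at_right
  rw [Nat.eq_of_mul_eq_mul_left Nat.card_pos at_right, Nat.card_zmod] at at_middle
  exact Nat.prime_three.prime.irreducible.not_isSquare ⟨_, at_middle.symm⟩
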